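/- Let Ā ∈ ℝ^{M×N}, let P ∈ ℝ^{N×N} be a symmetric positive semidefinite matrix, let λ₂ ≥ 0 and C₂ ≥ 0 be such that √(vᵀPv) ≤ C₂‖v‖₂ for every v ∈ ℝ^N, and let α ∈ ℝ^N be K-sparse with y = Āα. If every nonzero vector v in the kernel of Ā satisfies ‖v‖₁ ≥ (2√K + λ₂C₂)·‖v‖₂, then α is a global minimizer of the functional θ ↦ ‖θ‖₁ + λ₂·√(θᵀPθ) over the affine set {θ ∈ ℝ^N : Āθ = y}; that is, for every θ ∈ ℝ^N with Āθ = y one has ‖α‖₁ + λ₂√(αᵀPα) ≤ ‖θ‖₁ + λ₂√(θᵀPθ). -/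

import Mathlib

open Matrix Finset

/-- Cauchy–Schwarz inequality for the semi-inner product of a positive semidefinite matrix. -/
theorem dotProduct_mulVec_sq_le {ι : Type*} [Fintype ι] {P : Matrix ι ι ℝ} (hP : P.IsSymm)
    (hpos : ∀ v : ι → ℝ, 0 ≤ v ⬝ᵥ P.mulVec v) (u w : ι → ℝ) :
    (u ⬝ᵥ P.mulVec w) ^ 2 ≤ (u ⬝ᵥ P.mulVec u) * (w ⬝ᵥ P.mulVec w) := by
  have hcomm : w ⬝ᵥ P.mulVec u = u ⬝ᵥ P.mulVec w := by
    rw [dotProduct_mulVec, ← mulVec_transpose, hP.eq, dotProduct_comm]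
  have h := discrim_le_zero (a := w ⬝ᵥ P.mulVec w) (b := 2 * (u ⬝ᵥ P.mulVec w))
    (c := u ⬝ᵥ P.mulVec u) fun t => by
      have := hpos (u + t • w)
      simp only [mulVec_add, mulVec_smul, dotProduct_add, add_dotProduct, dotProduct_smul,
        smul_dotProduct, smul_eq_mul, hcomm] at this
      linarith
  rw [discrim] at h
  linarith

/-- Triangle inequality for the seminorm `v ↦ √(vᵀPv)` of a positive semidefinite matrix. -/
theorem sqrt_dotProduct_mulVec_add_le {ι : Type*} [Fintype ι] {P : Matrix ι ι ℝ}
    (hP : P.IsSymm) (hpos : ∀ v : ι → ℝ, 0 ≤ v ⬝ᵥ P.mulVec v) (u w : ι → ℝ) :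
    √((u + w) ⬝ᵥ P.mulVec (u + w)) ≤ √(u ⬝ᵥ P.mulVec u) + √(w ⬝ᵥ P.mulVec w) := by
  have hcomm : w ⬝ᵥ P.mulVec u = u ⬝ᵥ P.mulVec w := by
    rw [dotProduct_mulVec, ← mulVec_transpose, hP.eq, dotProduct_comm]
  have hcs : u ⬝ᵥ P.mulVec w ≤ √(u ⬝ᵥ P.mulVec u) * √(w ⬝ᵥ P.mulVec w) := by
    rw [← Real.sqrt_mul (hpos u)]
    exact Real.le_sqrt_of_sq_le (dotProduct_mulVec_sq_le hP hpos u w)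
  refine Real.sqrt_le_iff.mpr ⟨by positivity, ?_⟩
  simp only [mulVec_add, dotProduct_add, add_dotProduct, hcomm, add_sq,
    Real.sq_sqrt (hpos u), Real.sq_sqrt (hpos w)]
  linarith

/-- The `ℓ¹` norm over an index set with at most `K` elements is at most `√K` times the `ℓ²` norm. -/
theorem sum_abs_le_sqrt_mul_sqrt_sum_sq {ι : Type*} [Fintype ι] {S : Finset ι} {K : ℕ}
    (hS : S.card ≤ K) (v : ι → ℝ) : ∑ n ∈ S, |v n| ≤ √K * √(∑ n, v n ^ 2) := by
  rw [← Real.sqrt_mul (Nat.cast_nonneg K)]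
  refine Real.le_sqrt_of_sq_le ?_
  calc (∑ n ∈ S, |v n|) ^ 2 ≤ S.card * ∑ n ∈ S, |v n| ^ 2 := sq_sum_le_card_mul_sum_sq
    _ = S.card * ∑ n ∈ S, v n ^ 2 := by simp only [sq_abs]
    _ ≤ K * ∑ n, v n ^ 2 := by
      gcongr
      exact S.subset_univ

/-- The `ℓ¹` norm grows by at least the perturbation off the support minus that on the support. -/
theorem sum_abs_add_sum_abs_sub_le {ι : Type*} [Fintype ι] (α v : ι → ℝ) :
    ∑ n, |α n| + ∑ n, |v n| ≤
      ∑ n, |α n + v n| + 2 * ∑ n ∈ univ.filter fun n => α n ≠ 0, |v n| := by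
  rw [sum_filter, mul_sum, ← sum_add_distrib, ← sum_add_distrib]
  refine sum_le_sum fun n _ => ?_
  split_ifs with h
  · have := abs_sub_abs_le_abs_sub (α n) (-v n)
    rw [sub_neg_eq_add, abs_neg] at this
    linarith
  · simp [not_not.mp h]

/-- **Deterministic core of Theorem 1 (sufficient condition).**
If the null-space property `‖v‖₁ ≥ (2√K + λ₂C₂)‖v‖₂` holds on `ker Ā`, then a `K`-sparse
solution `α` of `Āθ = y` globally minimizes `θ ↦ ‖θ‖₁ + λ₂√(θᵀPθ)` over `{θ : Āθ = y}`. -/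
theorem robust_l1_recovery
    {M N : ℕ} (K : ℕ) (Abar : Matrix (Fin M) (Fin N) ℝ)
    (P : Matrix (Fin N) (Fin N) ℝ) (hPsymm : P.IsSymm)
    (hPpsd : ∀ v : Fin N → ℝ, 0 ≤ v ⬝ᵥ P.mulVec v)
    (lam2 C2 : ℝ) (hlam2 : 0 ≤ lam2) (hC2 : 0 ≤ C2)
    (hPbound : ∀ v : Fin N → ℝ,
      Real.sqrt (v ⬝ᵥ P.mulVec v) ≤ C2 * Real.sqrt (∑ n, (v n) ^ 2))
    (α : Fin N → ℝ)
    (hsparse : (Finset.univ.filter fun n => α n ≠ 0).card ≤ K)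
    (y : Fin M → ℝ) (hy : Abar.mulVec α = y)
    (hNSP : ∀ v : Fin N → ℝ, Abar.mulVec v = 0 → v ≠ 0 →
      (2 * Real.sqrt K + lam2 * C2) * Real.sqrt (∑ n, (v n) ^ 2) ≤ ∑ n, |v n|) :
    ∀ θ : Fin N → ℝ, Abar.mulVec θ = y →
      (∑ n, |α n|) + lam2 * Real.sqrt (α ⬝ᵥ P.mulVec α) ≤
        (∑ n, |θ n|) + lam2 * Real.sqrt (θ ⬝ᵥ P.mulVec θ) := by
  intro θ hθ
  obtain ⟨v, rfl⟩ : ∃ v, θ = α + v := ⟨θ - α, by abel⟩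
  have hker : Abar.mulVec v = 0 := by
    rwa [mulVec_add, hy, add_eq_left] at hθ
  have hnull : (2 * √K + lam2 * C2) * √(∑ n, v n ^ 2) ≤ ∑ n, |v n| := by
    by_cases hv : v = 0
    · simp [hv]
    · exact hNSP v hker hv
  have htri := sqrt_dotProduct_mulVec_add_le hPsymm hPpsd (α + v) (-v)
  simp only [add_neg_cancel_right, mulVec_neg, neg_dotProduct_neg] at htri
  have hq := mul_le_mul_of_nonneg_left (htri.trans (add_le_add_right (hPbound v) _)) hlam2
  have hS := sum_abs_le_sqrt_mul_sqrt_sum_sq hsparse v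
  have hl := sum_abs_add_sum_abs_sub_le α v
  simp only [Pi.add_apply]
  linarith
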